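/- For every Coxeter matrix M on a finite index set whose associated Coxeter group is finite, any two elements of the Artin–Tits monoid A^+(M) admit a least common right-multiple: for all a, b in A^+(M) there exists c such that a left-divides c, b left-divides c, and c left-divides every common right-multiple of a and b. -/

import Mathlib

/-- In a monoid, `a` left-divides `b` if `b = a * c` for some `c`. -/
def LeftDvd {M : Type*} [Monoid M] (a b : M) : Prop := ∃ c, b = a * c

open CoxeterSystem in
/-- The Artin–Tits relations associated with a Coxeter matrix `M`: for each pair `a ≠ b`
with `M a b` finite (Mathlib's convention: `M a b = 0` encodes `∞`), the two alternating
products `s_a s_b s_a ⋯` and `s_b s_a s_b ⋯` of length `M a b` are equated. -/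
def artinTitsRels {B : Type*} (M : CoxeterMatrix B) :
    FreeMonoid B → FreeMonoid B → Prop := fun x y =>
  ∃ a b : B, a ≠ b ∧ M a b ≠ 0 ∧
    x = FreeMonoid.ofList (alternatingWord a b (M a b)) ∧
    y = FreeMonoid.ofList (alternatingWord b a (M a b))

/-- The Artin–Tits monoid `A⁺(M)` of a Coxeter matrix `M`. -/
def ArtinTitsMonoid {B : Type*} (M : CoxeterMatrix B) := PresentedMonoid (artinTitsRels M)

instance {B : Type*} (M : CoxeterMatrix B) : Monoid (ArtinTitsMonoid M) :=
  inferInstanceAs (Monoid (PresentedMonoid (artinTitsRels M)))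

namespace CoxeterMatrix

open Module Polynomial.Chebyshev

variable {B : Type*} (M : CoxeterMatrix B)

/-- The linear form `v ↦ 2⟨e_a, v⟩` of the geometric representation of a Coxeter matrix. -/
noncomputable def coroot (a : B) : (B →₀ ℝ) →ₗ[ℝ] ℝ :=
  Finsupp.linearCombination ℝ fun b => -(2 * Real.cos (Real.pi / M a b))

lemma coroot_single (a b : B) :
    M.coroot a (Finsupp.single b 1) = -(2 * Real.cos (Real.pi / M a b)) := by
  simp [coroot]

lemma coroot_single_self (a : B) : M.coroot a (Finsupp.single a 1) = 2 := by
  simp [coroot_single]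

/-- The reflection by which a generator acts in the geometric representation. -/
noncomputable def geomReflection (a : B) : (B →₀ ℝ) ≃ₗ[ℝ] (B →₀ ℝ) :=
  reflection (M.coroot_single_self a)

lemma coroot_mul_coroot_sub_two (a b : B) :
    M.coroot a (Finsupp.single b 1) * M.coroot b (Finsupp.single a 1) - 2 =
      2 * Real.cos (2 * Real.pi / M a b) := by
  rw [coroot_single, coroot_single, M.symmetric b a,
    show 2 * Real.pi / M a b = 2 * (Real.pi / M a b) by ring, Real.cos_two_mul]
  ring

lemma sin_two_pi_div_pos {m : ℕ} (hm : 3 ≤ m) : 0 < Real.sin (2 * Real.pi / m) := by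
  have hm' : (3 : ℝ) ≤ m := by exact_mod_cast hm
  apply Real.sin_pos_of_pos_of_lt_pi
  · have := Real.pi_pos
    positivity
  · rw [div_lt_iff₀ (by linarith)]
    nlinarith [Real.pi_pos]

lemma S_two_cos_eq_zero {m : ℕ} (hm : 3 ≤ m) (k : ℤ) (hk : 2 * (k + 1) = m) :
    (S ℝ k).eval (2 * Real.cos (2 * Real.pi / m)) = 0 := by
  have h := S_two_mul_real_cos (2 * Real.pi / m) k
  have hk' : (2 : ℝ) * (k + 1) = m := by exact_mod_cast hk
  have hm0 : (m : ℝ) ≠ 0 := by positivity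
  rw [show ((k : ℝ) + 1) * (2 * Real.pi / m) = Real.pi by field_simp; linarith, Real.sin_pi] at h
  exact (mul_eq_zero.1 h).resolve_right (sin_two_pi_div_pos hm).ne'

lemma S_two_cos_add_eq_zero {m : ℕ} (hm : 3 ≤ m) (k : ℤ) (hk : 2 * k + 1 = m) :
    (S ℝ k).eval (2 * Real.cos (2 * Real.pi / m)) +
      (S ℝ (k - 1)).eval (2 * Real.cos (2 * Real.pi / m)) = 0 := by
  have h := S_two_mul_real_cos (2 * Real.pi / m) k
  have h' := S_two_mul_real_cos (2 * Real.pi / m) (k - 1)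
  have hk' : (2 : ℝ) * k + 1 = m := by exact_mod_cast hk
  have hm0 : (m : ℝ) ≠ 0 := by positivity
  rw [show ((k : ℝ) + 1) * (2 * Real.pi / m) = 2 * Real.pi - k * (2 * Real.pi / m) by
    field_simp; linarith, Real.sin_two_pi_sub] at h
  push_cast at h'
  rw [sub_add_cancel] at h'
  refine (mul_eq_zero.1 (?_ : _ * Real.sin (2 * Real.pi / m) = 0)).resolve_right
    (sin_two_pi_div_pos hm).ne'
  rw [add_mul, h, h', neg_add_cancel]

lemma isLiftable_geomReflection : M.IsLiftable M.geomReflection := by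
  intro a b
  obtain h0 | h1 | h2 | h3 : M a b = 0 ∨ M a b = 1 ∨ M a b = 2 ∨ 3 ≤ M a b := by omega
  · simp [h0]
  · have hab : a = b := by
      by_contra hab
      exact M.off_diagonal a b hab h1
    subst hab
    ext v : 1
    simpa [geomReflection, LinearEquiv.mul_apply] using
      involutive_reflection (M.coroot_single_self a) v
  · have hab : M.coroot a (Finsupp.single b 1) = 0 := by simp [coroot_single, h2]
    have hba : M.coroot b (Finsupp.single a 1) = 0 := by
      simp [coroot_single, M.symmetric b a, h2]
    rw [h2]
    ext v : 1
    simp only [pow_two, LinearEquiv.mul_apply, geomReflection, reflection_apply, map_sub, map_smul,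
      coroot_single_self, hab, hba, LinearEquiv.coe_one, id]
    module
  · apply LinearEquiv.toLinearMap_injective
    rw [geomReflection, geomReflection, reflection_mul_reflection_pow _ _ _ _
      (M.coroot_mul_coroot_sub_two a b).symm]
    obtain ⟨k, hk⟩ | ⟨k, hk⟩ := Nat.even_or_odd (M a b)
    · have e1 : ((M a b : ℤ) - 2) / 2 = k - 1 := by omega
      have e2 : ((M a b : ℤ) - 1) / 2 = k - 1 := by omega
      rw [e1, e2, S_two_cos_eq_zero h3 (k - 1) (by omega)]
      simp
    · have e1 : ((M a b : ℤ) - 2) / 2 = k - 1 := by omega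
      have e2 : ((M a b : ℤ) - 1) / 2 = k := by omega
      have e3 : ((M a b : ℤ) - 3) / 2 = k - 1 := by omega
      have e4 : (M a b : ℤ) / 2 = k := by omega
      rw [e1, e2, e3, e4, S_two_cos_add_eq_zero h3 k (by omega)]
      simp

lemma dvd_of_geomReflection_pow_eq_one {a b : B} (hab : a ≠ b) {j : ℕ}
    (h : (M.geomReflection a * M.geomReflection b) ^ j = 1) : M a b ∣ j := by
  have h1 := congrArg (fun f => f (Finsupp.single a 1)) h
  simp only [geomReflection] at h1
  rw [reflection_mul_reflection_pow_apply_self _ _ _ _ (M.coroot_mul_coroot_sub_two a b).symm] at h1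
  have hx := congrArg (fun f => f a) h1
  have hy := congrArg (fun f => f b) h1
  simp only [Finsupp.add_apply, Finsupp.smul_apply, Finsupp.single_eq_same, smul_eq_mul,
    Finsupp.single_eq_of_ne hab, Finsupp.single_eq_of_ne hab.symm, mul_one, mul_zero, add_zero,
    zero_add, LinearEquiv.coe_one, id, coroot_single, neg_neg, M.symmetric b a] at hx hy
  obtain h0 | h2 | h3 : M a b = 0 ∨ M a b = 2 ∨ 3 ≤ M a b := by
    have := M.off_diagonal a b hab
    omega
  · rw [h0] at hy ⊢
    simp [S_eval_two] at hy
    simp [hy]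
  · rw [h2] at hx ⊢
    rw [show 2 * Real.cos (2 * Real.pi / (2 : ℕ)) = -2 by simp, S_eval_neg_two,
      S_eval_neg_two] at hx
    rw [← even_iff_two_dvd]
    by_contra hj
    rw [Nat.not_even_iff_odd] at hj
    rw [Int.negOnePow_odd _ (by exact_mod_cast hj), Int.negOnePow_sub,
      Int.negOnePow_odd _ (by exact_mod_cast hj)] at hx
    simp at hx
    linarith
  · have hs := sin_two_pi_div_pos h3
    have hm : (3 : ℝ) ≤ M a b := by exact_mod_cast h3
    have hc : Real.cos (Real.pi / M a b) ≠ 0 := by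
      apply (Real.cos_pos_of_mem_Ioo ⟨_, _⟩).ne'
      · have : 0 < Real.pi / M a b := by have := Real.pi_pos; positivity
        linarith [Real.pi_pos]
      · apply div_lt_div_of_pos_left Real.pi_pos (by norm_num) (by linarith)
    have hS : (S ℝ ((j : ℤ) - 1)).eval (2 * Real.cos (2 * Real.pi / M a b)) = 0 := by
      simpa [hc] using hy
    rw [hS, add_zero] at hx
    have e1 := S_two_mul_real_cos (2 * Real.pi / M a b) j
    have e2 := S_two_mul_real_cos (2 * Real.pi / M a b) ((j : ℤ) - 1)
    rw [hx] at e1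
    rw [hS] at e2
    push_cast at e1 e2
    rw [sub_add_cancel, zero_mul] at e2
    rw [add_mul, one_mul, one_mul, Real.sin_add, ← e2, zero_mul, zero_add] at e1
    have hcos : Real.cos (j * (2 * Real.pi / M a b)) = 1 :=
      mul_right_cancel₀ hs.ne' (by linarith)
    obtain ⟨n, hn⟩ := (Real.cos_eq_one_iff _).1 hcos
    have : (n : ℝ) * M a b = j := by
      have := Real.pi_pos
      field_simp at hn
      nlinarith
    exact Int.natCast_dvd_natCast.1 ⟨n, by rw [mul_comm]; exact_mod_cast this.symm⟩

end CoxeterMatrix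

namespace CoxeterSystem

open List

variable {B W : Type*} [Group W] {M : CoxeterMatrix B} (cs : CoxeterSystem M W)

/-- The order of `s_a s_b` in a Coxeter group is exactly `M a b` (with `0` encoding `∞`). -/
theorem dvd_of_simple_mul_simple_pow_eq_one {a b : B} (hab : a ≠ b) {j : ℕ}
    (h : (cs.simple a * cs.simple b) ^ j = 1) : M a b ∣ j := by
  apply M.dvd_of_geomReflection_pow_eq_one hab
  have := congrArg (cs.lift ⟨_, M.isLiftable_geomReflection⟩) h
  simpa only [map_pow, map_mul, map_one, lift_apply_simple] using this

/-- The involution of `W × ZMod 2` by which a generator acts in the signed conjugation action. -/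
noncomputable def signedConj (i : B) : Equiv.Perm (W × ZMod 2) :=
  open Classical in
  Function.Involutive.toPerm
    (fun p => (cs.simple i * p.1 * cs.simple i, p.2 + if p.1 = cs.simple i then 1 else 0)) <| by
    rintro ⟨r, ε⟩
    have h2 : (1 + 1 : ZMod 2) = 0 := by decide
    by_cases h : r = cs.simple i
    · simp [h, add_assoc, h2]
    · have h' : ¬ r * cs.simple i = 1 := by
        rwa [mul_eq_one_iff_eq_inv, inv_simple]
      simp [h, h', mul_assoc]

open Classical in
lemma signedConj_apply (i : B) (r : W) (ε : ZMod 2) :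
    cs.signedConj i (r, ε) =
      (cs.simple i * r * cs.simple i, ε + if r = cs.simple i then 1 else 0) :=
  rfl

open Classical in
lemma prod_signedConj_apply (ω : List B) (r : W) (ε : ZMod 2) :
    (ω.map cs.signedConj).prod (r, ε) =
      (cs.wordProd ω * r * (cs.wordProd ω)⁻¹, ε + (cs.rightInvSeq ω).count r) := by
  induction ω with
  | nil => simp
  | cons i ω ih =>
    have e : cs.wordProd ω * r * (cs.wordProd ω)⁻¹ = cs.simple i ↔
        (cs.wordProd ω)⁻¹ * cs.simple i * cs.wordProd ω = r := by
      constructor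
      · intro h
        rw [← h]
        group
      · intro h
        rw [← h]
        group
    rw [map_cons, prod_cons, Equiv.Perm.mul_apply, ih, signedConj_apply, rightInvSeq, count_cons]
    simp only [e]
    simp only [wordProd_cons, mul_inv_rev, inv_simple, beq_iff_eq, Nat.cast_add, Nat.cast_ite,
      Nat.cast_one, Nat.cast_zero, mul_assoc, add_assoc]

lemma prod_map_reverse_alternatingWord {G : Type*} [Monoid G] (f : B → G) (i j : B) (m : ℕ) :
    ((alternatingWord i j (2 * m)).reverse.map f).prod = (f j * f i) ^ m := by
  induction m with
  | zero => simp [alternatingWord]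
  | succ m ih =>
    rw [show 2 * (m + 1) = 2 * m + 1 + 1 by ring, alternatingWord_succ, alternatingWord_succ]
    rw [map_reverse] at ih
    simp [pow_succ', ih, mul_assoc]

open Classical in
lemma even_count_leftInvSeq_alternatingWord (i j : B) (r : W) :
    Even ((cs.leftInvSeq (alternatingWord i j (2 * M i j))).count r) := by
  set L := cs.leftInvSeq (alternatingWord i j (2 * M i j)) with hL
  have hlen : L.length = 2 * M i j := by simp [hL]
  have hdrop : L.drop (M i j) = L.take (M i j) := by
    apply List.ext_getElem
    · simp [hlen]
      omega
    · intro k hk hk'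
      have hkm : k < M i j := by
        simp [hlen] at hk'
        exact hk'.1
      rw [getElem_drop, getElem_take]
      simp only [hL]
      rw [cs.getElem_leftInvSeq_alternatingWord i j _ _ (by omega),
        cs.getElem_leftInvSeq_alternatingWord i j _ _ (by omega),
        prod_alternatingWord_eq_mul_pow, prod_alternatingWord_eq_mul_pow]
      have o1 : ¬ Even (2 * (M i j + k) + 1) := by simp [parity_simps]
      have o2 : ¬ Even (2 * k + 1) := by simp [parity_simps]
      rw [if_neg o1, if_neg o2, show (2 * (M i j + k) + 1) / 2 = M j i + k by
        rw [M.symmetric j i]; omega, pow_add, cs.simple_mul_simple_pow, one_mul,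
        show (2 * k + 1) / 2 = k by omega]
  rw [← List.take_append_drop (M i j) L, count_append, hdrop]
  exact ⟨_, rfl⟩

lemma isLiftable_signedConj : M.IsLiftable cs.signedConj := by
  classical
  intro j i
  rw [M.symmetric j i, ← prod_map_reverse_alternatingWord]
  ext1 ⟨r, ε⟩
  rw [prod_signedConj_apply, rightInvSeq_reverse, count_reverse,
    (ZMod.natCast_eq_zero_iff_even).2 (cs.even_count_leftInvSeq_alternatingWord i j r)]
  have : cs.wordProd (alternatingWord i j (2 * M i j)).reverse = 1 := by
    rw [wordProd, prod_map_reverse_alternatingWord, M.symmetric i j, simple_mul_simple_pow]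
  simp [this]

/-- The signed conjugation action of `W` on `W × ZMod 2`, whose sign records inversions. -/
noncomputable def signedConjHom : W →* Equiv.Perm (W × ZMod 2) :=
  cs.lift ⟨cs.signedConj, cs.isLiftable_signedConj⟩

open Classical in
lemma signedConjHom_wordProd_apply (ω : List B) (r : W) (ε : ZMod 2) :
    cs.signedConjHom (cs.wordProd ω) (r, ε) =
      (cs.wordProd ω * r * (cs.wordProd ω)⁻¹, ε + (cs.rightInvSeq ω).count r) := by
  rw [← prod_signedConj_apply, wordProd, map_list_prod, List.map_map]
  congr 4
  ext1 i
  exact cs.lift_apply_simple _ i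

lemma signedConjHom_reflection_apply {t : W} (ht : cs.IsReflection t) (ε : ZMod 2) :
    cs.signedConjHom t (t, ε) = (t, ε + 1) := by
  classical
  obtain ⟨w, i, rfl⟩ := ht
  obtain ⟨ω, rfl⟩ := cs.wordProd_surjective w
  have key : ∀ δ : ZMod 2, cs.signedConjHom (cs.wordProd ω) (cs.simple i, δ) =
      (cs.wordProd ω * cs.simple i * (cs.wordProd ω)⁻¹,
        δ + (cs.rightInvSeq ω).count (cs.simple i)) :=
    fun δ => cs.signedConjHom_wordProd_apply ω _ δ
  have hs : ∀ δ : ZMod 2, cs.signedConjHom (cs.simple i) (cs.simple i, δ) =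
      (cs.simple i, δ + 1) := by
    intro δ
    simpa [rightInvSeq] using cs.signedConjHom_wordProd_apply [i] (cs.simple i) δ
  have hinv : (cs.signedConjHom (cs.wordProd ω))⁻¹
      (cs.wordProd ω * cs.simple i * (cs.wordProd ω)⁻¹, ε) =
      (cs.simple i, ε - (cs.rightInvSeq ω).count (cs.simple i)) := by
    rw [Equiv.Perm.inv_eq_iff_eq, key, sub_add_cancel]
  rw [map_mul, map_mul, map_inv, Equiv.Perm.mul_apply, Equiv.Perm.mul_apply, hinv, hs, key]
  congr 1
  ring

/-- The strong exchange property. -/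
theorem mem_rightInvSeq_of_isRightInversion {ω : List B} {t : W}
    (h : cs.IsRightInversion (cs.wordProd ω) t) : t ∈ cs.rightInvSeq ω := by
  classical
  by_contra hmem
  obtain ⟨η, hη, he⟩ := cs.exists_isReduced (cs.wordProd ω * t)
  have h1 : cs.signedConjHom (cs.wordProd ω * t) (t, 0) =
      (cs.wordProd ω * t * (cs.wordProd ω)⁻¹, 1) := by
    rw [map_mul, Equiv.Perm.mul_apply, cs.signedConjHom_reflection_apply h.1,
      signedConjHom_wordProd_apply, count_eq_zero_of_not_mem hmem]
    simp
  rw [he, signedConjHom_wordProd_apply] at h1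
  have h2 := congrArg Prod.snd h1
  have h3 : t ∈ cs.rightInvSeq η := by
    by_contra h3
    simp [count_eq_zero_of_not_mem h3] at h2
  have h4 := cs.isRightInversion_of_mem_rightInvSeq hη h3
  rw [← he, h.1.isRightInversion_mul_left_iff] at h4
  exact h4 h

theorem mem_leftInvSeq_of_isLeftInversion {ω : List B} {t : W}
    (h : cs.IsLeftInversion (cs.wordProd ω) t) : t ∈ cs.leftInvSeq ω := by
  rw [← isRightInversion_inv_iff, ← wordProd_reverse] at h
  simpa [rightInvSeq_reverse] using cs.mem_rightInvSeq_of_isRightInversion h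

lemma mem_leftInvSeq_append {ω η : List B} {t : W} (h : t ∈ cs.leftInvSeq (ω ++ η)) :
    t ∈ cs.leftInvSeq ω ∨ (cs.wordProd ω)⁻¹ * t * cs.wordProd ω ∈ cs.leftInvSeq η := by
  induction ω generalizing t with
  | nil => simpa using h
  | cons i ω ih =>
    simp only [cons_append, leftInvSeq, mem_cons, mem_map] at h ⊢
    obtain rfl | ⟨r, hr, rfl⟩ := h
    · exact .inl (.inl rfl)
    · obtain hr | hr := ih hr
      · exact .inl (.inr ⟨r, hr, rfl⟩)
      · right
        convert hr using 1
        simp [wordProd_cons, mul_assoc]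

/-- An inversion of a product comes from an inversion of one of the factors. -/
theorem IsLeftInversion.of_mul {x y t : W} (h : cs.IsLeftInversion (x * y) t) :
    cs.IsLeftInversion x t ∨ cs.IsLeftInversion y (x⁻¹ * t * x) := by
  obtain ⟨ω, hω, rfl⟩ := cs.exists_isReduced x
  obtain ⟨η, hη, rfl⟩ := cs.exists_isReduced y
  rw [← wordProd_append] at h
  obtain h | h := cs.mem_leftInvSeq_append (cs.mem_leftInvSeq_of_isLeftInversion h)
  · exact .inl (cs.isLeftInversion_of_mem_leftInvSeq hω h)
  · exact .inr (cs.isLeftInversion_of_mem_leftInvSeq hη h)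

end CoxeterSystem

/-- The alternating word `a b a ⋯` of length `k` starting with `a`. -/
def altList {B : Type*} (a b : B) : ℕ → List B
  | 0 => []
  | k + 1 => a :: altList b a k

section altList

variable {B : Type*}

lemma altList_succ (a b : B) (k : ℕ) : altList a b (k + 1) = a :: altList b a k := rfl

lemma length_altList (a b : B) (k : ℕ) : (altList a b k).length = k := by
  induction k generalizing a b with
  | zero => rfl
  | succ k ih => simp [altList_succ, ih]

lemma altList_succ_eq_append (a b : B) (k : ℕ) :
    altList a b (k + 1) = altList a b k ++ [if Even k then a else b] := by
  induction k generalizing a b with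
  | zero => simp [altList]
  | succ k ih =>
    rw [altList_succ, ih, altList_succ a b k, List.cons_append]
    by_cases hk : Even k <;> simp [hk, parity_simps]

lemma alternatingWord_eq_altList (a b : B) (k : ℕ) :
    CoxeterSystem.alternatingWord a b k = if Even k then altList a b k else altList b a k := by
  induction k with
  | zero => rfl
  | succ k ih =>
    rw [CoxeterSystem.alternatingWord_succ', ih]
    by_cases hk : Even k <;> simp [hk, altList_succ, parity_simps]

end altList

namespace CoxeterSystem

variable {B W : Type*} [Group W] {M : CoxeterMatrix B} (cs : CoxeterSystem M W)

lemma wordProd_altList_two_mul (a b : B) (j : ℕ) :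
    cs.wordProd (altList a b (2 * j)) = (cs.simple a * cs.simple b) ^ j := by
  induction j with
  | zero => simp [altList]
  | succ j ih =>
    rw [show 2 * (j + 1) = 2 * j + 1 + 1 by ring, altList_succ, altList_succ, wordProd_cons,
      wordProd_cons, ih, pow_succ', mul_assoc]

lemma wordProd_altList_braid (a b : B) :
    cs.wordProd (altList a b (M a b)) = cs.wordProd (altList b a (M a b)) := by
  have h := cs.wordProd_braidWord_eq a b
  rw [braidWord, braidWord, M.symmetric b a, alternatingWord_eq_altList,
    alternatingWord_eq_altList] at h
  split_ifs at h
  · exact h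
  · exact h.symm

lemma exists_of_mem_leftInvSeq_altList {a b : B} {k : ℕ} {r : W}
    (h : r ∈ cs.leftInvSeq (altList a b k)) :
    ∃ j < k, r = cs.wordProd (altList a b (2 * j + 1)) := by
  induction k generalizing a b r with
  | zero => simp [altList] at h
  | succ k ih =>
    simp only [altList_succ, leftInvSeq, List.mem_cons, List.mem_map] at h
    obtain rfl | ⟨r, hr, rfl⟩ := h
    · exact ⟨0, by omega, by simp [altList]⟩
    · obtain ⟨j, hj, rfl⟩ := ih hr
      refine ⟨j + 1, by omega, ?_⟩
      rw [show 2 * (j + 1) + 1 = 2 * j + 1 + 1 + 1 by ring, altList_succ a b (2 * j + 1 + 1),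
        altList_succ_eq_append b a (2 * j + 1), wordProd_cons, wordProd_append]
      simp [parity_simps, mul_assoc]

/-- Alternating words of length at most `M a b` are reduced. -/
lemma length_wordProd_altList {a b : B} (hab : a ≠ b) {k : ℕ} (hk : M a b = 0 ∨ k ≤ M a b) :
    cs.length (cs.wordProd (altList a b k)) = k := by
  induction k generalizing a b with
  | zero => simp [altList]
  | succ k ih =>
    have ih' := ih hab.symm (by rw [M.symmetric b a]; omega)
    rw [altList_succ, wordProd_cons]
    conv_rhs => rw [← ih']
    rw [← not_isLeftDescent_iff, ← isLeftInversion_simple_iff_isLeftDescent]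
    intro h
    obtain ⟨j, hj, hj'⟩ :=
      cs.exists_of_mem_leftInvSeq_altList (cs.mem_leftInvSeq_of_isLeftInversion h)
    have h1 : (cs.simple a * cs.simple b) ^ (j + 1) = 1 := by
      rw [← wordProd_altList_two_mul, show 2 * (j + 1) = 2 * j + 1 + 1 by ring, altList_succ,
        wordProd_cons, ← hj', simple_mul_simple_self]
    have h2 := cs.dvd_of_simple_mul_simple_pow_eq_one hab h1
    obtain h0 | h0 := hk
    · simp [h0] at h2
    · have := Nat.le_of_dvd (by omega) h2
      omega

lemma exists_altList_of_mem_closure {a b : B} {p : W}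
    (hp : p ∈ Subgroup.closure {cs.simple a, cs.simple b}) :
    ∃ k, (M a b = 0 ∨ k ≤ M a b) ∧
      (p = cs.wordProd (altList a b k) ∨ p = cs.wordProd (altList b a k)) := by
  have key : ∀ c d : B, ∀ k, (M c d = 0 ∨ k ≤ M c d) →
      ∃ l, (M c d = 0 ∨ l ≤ M c d) ∧
      (cs.simple c * cs.wordProd (altList d c k) = cs.wordProd (altList c d l) ∨
        cs.simple c * cs.wordProd (altList d c k) = cs.wordProd (altList d c l)) := by
    intro c d k hk
    by_cases hk' : M c d = 0 ∨ k + 1 ≤ M c d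
    · exact ⟨k + 1, hk', .inl (by rw [altList_succ, wordProd_cons])⟩
    · obtain rfl : k = M c d := by omega
      obtain ⟨l, hl⟩ := Nat.exists_eq_succ_of_ne_zero (fun h => hk' (.inl h))
      refine ⟨l, by omega, .inr ?_⟩
      rw [← wordProd_altList_braid, hl, Nat.succ_eq_add_one, altList_succ, wordProd_cons,
        simple_mul_simple_cancel_left]
  have key' : ∀ c d : B, ∀ k, (M c d = 0 ∨ k ≤ M c d) →
      ∃ l, (M c d = 0 ∨ l ≤ M c d) ∧
      (cs.simple c * cs.wordProd (altList c d k) = cs.wordProd (altList c d l) ∨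
        cs.simple c * cs.wordProd (altList c d k) = cs.wordProd (altList d c l)) := by
    intro c d k hk
    obtain _ | k := k
    · obtain ⟨l, hl, hl'⟩ := key c d 0 (by omega)
      exact ⟨l, hl, hl'⟩
    · refine ⟨k, by omega, .inr ?_⟩
      rw [altList_succ, wordProd_cons, simple_mul_simple_cancel_left]
  have step : ∀ x ∈ ({cs.simple a, cs.simple b} : Set W), ∀ p, (∃ k, (M a b = 0 ∨ k ≤ M a b) ∧
      (p = cs.wordProd (altList a b k) ∨ p = cs.wordProd (altList b a k))) →
      ∃ k, (M a b = 0 ∨ k ≤ M a b) ∧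
      (x * p = cs.wordProd (altList a b k) ∨ x * p = cs.wordProd (altList b a k)) := by
    rintro x (rfl | rfl) p ⟨k, hk, rfl | rfl⟩
    · exact key' a b k hk
    · exact key a b k hk
    · simp_rw [M.symmetric a b] at hk ⊢
      simpa only [or_comm] using key b a k hk
    · simp_rw [M.symmetric a b] at hk ⊢
      simpa only [or_comm] using key' b a k hk
  induction hp using Subgroup.closure_induction_left with
  | one => exact ⟨0, by omega, .inl (by simp [altList])⟩
  | mul_left x hx y _ ih => exact step x hx y ih
  | inv_mul_cancel x hx y _ ih =>
    have : x⁻¹ = x := by obtain rfl | rfl := hx <;> simp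
    rw [this]
    exact step x hx y ih

/-- An element with two left descents `a ≠ b` has the alternating word of length `M a b` as a
reduced prefix. -/
theorem length_eq_of_isLeftDescent {a b : B} (hab : a ≠ b) {w : W} (ha : cs.IsLeftDescent w a)
    (hb : cs.IsLeftDescent w b) :
    M a b ≠ 0 ∧
      M a b + cs.length ((cs.wordProd (altList a b (M a b)))⁻¹ * w) = cs.length w := by
  set H := Subgroup.closure {cs.simple a, cs.simple b} with hH
  have haH : cs.simple a ∈ H := Subgroup.subset_closure (by simp)
  have hbH : cs.simple b ∈ H := Subgroup.subset_closure (by simp)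
  obtain ⟨v, hv, hmin⟩ : ∃ v, w * v⁻¹ ∈ H ∧ ∀ h ∈ H, cs.length v ≤ cs.length (h * v) := by
    classical
    have hex : ∃ n v, w * v⁻¹ ∈ H ∧ cs.length v = n := ⟨_, w, by simp [H.one_mem], rfl⟩
    obtain ⟨v, hv, hvn⟩ := Nat.find_spec hex
    refine ⟨v, hv, fun h hh => ?_⟩
    rw [hvn]
    refine Nat.find_min' hex ⟨h * v, ?_, rfl⟩
    rw [mul_inv_rev, ← mul_assoc]
    exact H.mul_mem hv (H.inv_mem hh)
  have hmem : ∀ c d, cs.simple c ∈ H → cs.simple d ∈ H → ∀ k,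
      cs.wordProd (altList c d k) ∈ H := by
    intro c d hc hd k
    induction k generalizing c d with
    | zero => simp [altList, H.one_mem]
    | succ k ih =>
      rw [altList_succ, wordProd_cons]
      exact H.mul_mem hc (ih d c hd hc)
  have hlen : ∀ c d, c ≠ d → cs.simple c ∈ H → cs.simple d ∈ H → ∀ k, (M c d = 0 ∨ k ≤ M c d) →
      cs.length (cs.wordProd (altList c d k) * v) = k + cs.length v := by
    intro c d hcd hc hd k hk
    induction k generalizing c d with
    | zero => simp [altList]
    | succ k ih =>
      have hk' : M d c = 0 ∨ k ≤ M d c := by rw [M.symmetric d c]; omega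
      have ih' := ih d c hcd.symm hd hc hk'
      rw [altList_succ, wordProd_cons, mul_assoc, add_right_comm, ← ih', ← not_isLeftDescent_iff,
        ← isLeftInversion_simple_iff_isLeftDescent]
      intro h
      obtain h | h := h.of_mul
      · have h1 := cs.length_wordProd_altList hcd hk
        have h2 := cs.length_wordProd_altList hcd.symm hk'
        rw [altList_succ, wordProd_cons] at h1
        have := h.2
        omega
      · have hp := hmem d c hd hc k
        exact absurd h.2 (hmin _ (H.mul_mem (H.mul_mem (H.inv_mem hp) hc) hp)).not_gt
  have main : ∀ c d, c ≠ d → cs.simple c ∈ H → cs.simple d ∈ H → cs.IsLeftDescent w d → ∀ k,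
      (M c d = 0 ∨ k ≤ M c d) → w * v⁻¹ = cs.wordProd (altList c d k) → M c d ≠ 0 ∧ k = M c d := by
    intro c d hcd hc hd hdesc k hk hw
    by_contra hne
    have hk' : M d c = 0 ∨ k + 1 ≤ M d c := by rw [M.symmetric d c]; omega
    have h1 := hlen c d hcd hc hd k hk
    have h2 := hlen d c hcd.symm hd hc (k + 1) hk'
    rw [altList_succ, wordProd_cons, ← hw, mul_assoc, inv_mul_cancel_right] at h2
    rw [← hw, inv_mul_cancel_right] at h1
    rw [isLeftDescent_iff] at hdesc
    omega
  have fin : M a b ≠ 0 ∧ w * v⁻¹ = cs.wordProd (altList a b (M a b)) := by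
    obtain ⟨k, hk, hw | hw⟩ := cs.exists_altList_of_mem_closure hv
    · obtain ⟨h0, rfl⟩ := main a b hab haH hbH hb k hk hw
      exact ⟨h0, hw⟩
    · rw [M.symmetric a b] at hk ⊢
      obtain ⟨h0, rfl⟩ := main b a hab.symm hbH haH ha k hk hw
      refine ⟨h0, ?_⟩
      rw [hw, wordProd_altList_braid]
  refine ⟨fin.1, ?_⟩
  have h1 := hlen a b hab haH hbH _ (.inr le_rfl)
  rw [← fin.2] at h1 ⊢
  simpa using h1.symm

/-- The (right) weak order of a Coxeter group: `x` is a prefix of a reduced word of `y`. -/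
def WeakLE (x y : W) : Prop := cs.length x + cs.length (x⁻¹ * y) = cs.length y

section WeakLE

variable {cs} {x y z : W}

lemma WeakLE.refl (x : W) : cs.WeakLE x x := by simp [WeakLE]

lemma WeakLE.length_le (h : cs.WeakLE x y) : cs.length x ≤ cs.length y := by
  rw [WeakLE] at h
  omega

lemma WeakLE.trans (h : cs.WeakLE x y) (h' : cs.WeakLE y z) : cs.WeakLE x z := by
  rw [WeakLE] at *
  have h1 := cs.length_mul_le x (x⁻¹ * z)
  have h2 := cs.length_mul_le (x⁻¹ * y) (y⁻¹ * z)
  simp only [mul_inv_cancel_left, mul_assoc] at h1 h2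
  omega

lemma WeakLE.eq_of_length_le (h : cs.WeakLE x y) (hl : cs.length y ≤ cs.length x) : x = y := by
  rw [WeakLE] at h
  rw [← inv_mul_eq_one, ← cs.length_eq_zero_iff]
  omega

lemma WeakLE.antisymm (h : cs.WeakLE x y) (h' : cs.WeakLE y x) : x = y :=
  h.eq_of_length_le h'.length_le

lemma weakLE_mul_iff :
    cs.WeakLE x (x * y) ↔ cs.length x + cs.length y = cs.length (x * y) := by
  simp [WeakLE]

lemma weakLE_mul_left_iff (h : cs.WeakLE x (x * y)) :
    cs.WeakLE (x * y) z ↔ cs.WeakLE x z ∧ cs.WeakLE y (x⁻¹ * z) := by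
  constructor
  · intro h'
    have h1 := h.trans h'
    refine ⟨h1, ?_⟩
    rw [weakLE_mul_iff] at h
    rw [WeakLE] at *
    rw [mul_inv_rev, mul_assoc] at h'
    omega
  · rintro ⟨h1, h2⟩
    rw [weakLE_mul_iff] at h
    rw [WeakLE] at *
    rw [mul_inv_rev, mul_assoc]
    omega

lemma WeakLE.of_mul (h : cs.WeakLE (x * y) (x * y * z)) (h' : cs.WeakLE x (x * y)) :
    cs.WeakLE y (y * z) := by
  rw [weakLE_mul_iff] at *
  have h1 := cs.length_mul_le x (y * z)
  have h2 := cs.length_mul_le y z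
  rw [← mul_assoc] at h1
  omega

lemma weakLE_simple_iff {i : B} : cs.WeakLE (cs.simple i) x ↔ cs.IsLeftDescent x i := by
  rw [WeakLE, isLeftDescent_iff, length_simple, inv_simple, add_comm]

end WeakLE

end CoxeterSystem

/-- The Björner–Edelman–Ziegler criterion: in a ranked preorder, if any two elements one step
above a common element and bounded above have a least upper bound, then so have any two bounded
elements with a common lower bound. -/
theorem exists_least_upper_bound_of_local {P : Type*} (r step : P → P → Prop) (rk : P → ℕ)
    (refl : ∀ x, r x x) (trans : ∀ {x y z}, r x y → r y z → r x z)
    (rk_le : ∀ {x y}, r x y → rk x ≤ rk y) (rk_lt : ∀ {x y}, step x y → rk x < rk y)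
    (exists_step : ∀ {x y}, r x y → r y x ∨ ∃ z, step x z ∧ r z y)
    (exists_local : ∀ {z x y d}, step z x → step z y → r x d → r y d →
      ∃ j, r x j ∧ r y j ∧ ∀ e, r x e → r y e → r j e)
    {z a b d : P} (hza : r z a) (hzb : r z b) (had : r a d) (hbd : r b d) :
    ∃ j, r a j ∧ r b j ∧ ∀ e, r a e → r b e → r j e := by
  induction hn : rk d - rk z using Nat.strong_induction_on generalizing z a b with
  | _ n ih =>
    obtain haz | ⟨x, hx, hxa⟩ := exists_step hza
    · exact ⟨b, trans haz hzb, refl b, fun e _ h => h⟩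
    obtain hbz | ⟨y, hy, hyb⟩ := exists_step hzb
    · exact ⟨a, refl a, trans hbz hza, fun e h _ => h⟩
    have hlt : ∀ {u c}, step z u → r u c → r c d → rk d - rk u < n := by
      intro u c hu huc hcd
      have h1 := rk_lt hu
      have h2 := rk_le (trans huc hcd)
      omega
    obtain ⟨j₀, hxj, hyj, hj⟩ := exists_local hx hy (trans hxa had) (trans hyb hbd)
    have hj₀d := hj d (trans hxa had) (trans hyb hbd)
    obtain ⟨j₁, haj₁, hj₀j₁, hj₁⟩ := ih _ (hlt hx hxa had) hxa hxj had hj₀d rfl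
    have hj₁d := hj₁ d had hj₀d
    obtain ⟨j₂, hj₁j₂, hbj₂, hj₂⟩ :=
      ih _ (hlt hy hyb hbd) (trans hyj hj₀j₁) hyb hj₁d hbd rfl
    exact ⟨j₂, trans haj₁ hj₁j₂, hbj₂, fun e hae hbe =>
      hj₂ e (hj₁ e hae (hj e (trans hxa hae) (trans hyb hbe))) hbe⟩

namespace CoxeterSystem

variable {B W : Type*} [Group W] {M : CoxeterMatrix B} (cs : CoxeterSystem M W)

lemma weakLE_altList {a b : B} (hab : a ≠ b) {w : W} (ha : cs.WeakLE (cs.simple a) w)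
    (hb : cs.WeakLE (cs.simple b) w) :
    M a b ≠ 0 ∧ cs.WeakLE (cs.wordProd (altList a b (M a b))) w := by
  rw [weakLE_simple_iff] at ha hb
  obtain ⟨h0, h⟩ := cs.length_eq_of_isLeftDescent hab ha hb
  refine ⟨h0, ?_⟩
  rwa [WeakLE, cs.length_wordProd_altList hab (.inr le_rfl)]

lemma simple_weakLE_altList {a b : B} (hab : a ≠ b) (h0 : M a b ≠ 0) :
    cs.WeakLE (cs.simple a) (cs.wordProd (altList a b (M a b))) := by
  obtain ⟨l, hl⟩ := Nat.exists_eq_succ_of_ne_zero h0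
  have h1 := cs.length_wordProd_altList hab (k := M a b) (.inr le_rfl)
  have h2 := cs.length_wordProd_altList hab.symm (k := l) (by rw [M.symmetric b a]; omega)
  rw [weakLE_simple_iff, isLeftDescent_iff, h1]
  rw [hl, Nat.succ_eq_add_one, altList_succ, wordProd_cons, simple_mul_simple_cancel_left, h2]

lemma simple_weakLE_altList' {a b : B} (hab : a ≠ b) (h0 : M a b ≠ 0) :
    cs.WeakLE (cs.simple b) (cs.wordProd (altList a b (M a b))) := by
  rw [wordProd_altList_braid, M.symmetric a b]
  exact cs.simple_weakLE_altList hab.symm (by rwa [M.symmetric b a])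

/-- Two elements with a common upper bound in the weak order have a join. -/
theorem exists_weak_join {a b d : W} (had : cs.WeakLE a d) (hbd : cs.WeakLE b d) :
    ∃ j, cs.WeakLE a j ∧ cs.WeakLE b j ∧ ∀ e, cs.WeakLE a e → cs.WeakLE b e → cs.WeakLE j e := by
  have h1 : ∀ x, cs.WeakLE 1 x := fun x => by simp [WeakLE]
  refine exists_least_upper_bound_of_local cs.WeakLE
    (fun x y => ∃ i, y = x * cs.simple i ∧ cs.WeakLE x (x * cs.simple i)) cs.length
    WeakLE.refl WeakLE.trans WeakLE.length_le ?_ ?_ ?_ (h1 a) (h1 b) had hbd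
  · rintro x _ ⟨i, rfl, h⟩
    rw [weakLE_mul_iff, length_simple] at h
    omega
  · intro x y h
    by_cases hxy : x⁻¹ * y = 1
    · left
      rw [inv_mul_eq_one.1 hxy]
      exact .refl y
    · right
      obtain ⟨i, hi⟩ := cs.exists_leftDescent_of_ne_one hxy
      have hx : cs.WeakLE x (x * cs.simple i) := by
        rw [isLeftDescent_iff] at hi
        rw [weakLE_mul_iff, length_simple]
        rw [WeakLE] at h
        have h2 := cs.length_mul_le (x * cs.simple i) (cs.simple i * (x⁻¹ * y))
        have h3 := cs.length_mul_le x (cs.simple i)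
        simp only [mul_assoc, simple_mul_simple_cancel_left, mul_inv_cancel_left,
          length_simple] at h2 h3
        omega
      exact ⟨_, ⟨i, rfl, hx⟩, (weakLE_mul_left_iff hx).2 ⟨h, weakLE_simple_iff.2 hi⟩⟩
  · rintro z _ _ d ⟨a, rfl, ha⟩ ⟨b, rfl, hb⟩ had hbd
    by_cases hab : a = b
    · subst hab
      exact ⟨_, .refl _, .refl _, fun e h _ => h⟩
    rw [weakLE_mul_left_iff ha] at had
    rw [weakLE_mul_left_iff hb] at hbd
    obtain ⟨h0, hd⟩ := cs.weakLE_altList hab had.2 hbd.2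
    set p := cs.wordProd (altList a b (M a b)) with hp
    have hz : cs.WeakLE z (z * p) := by
      rw [weakLE_mul_iff]
      have h1 := had.1
      rw [WeakLE] at h1 hd
      have h2 := cs.length_mul_le (z * p) (p⁻¹ * (z⁻¹ * d))
      have h3 := cs.length_mul_le z p
      simp only [mul_assoc, mul_inv_cancel_left] at h2
      omega
    refine ⟨z * p, ?_, ?_, ?_⟩
    · rw [weakLE_mul_left_iff ha, inv_mul_cancel_left]
      exact ⟨hz, cs.simple_weakLE_altList hab h0⟩
    · rw [weakLE_mul_left_iff hb, inv_mul_cancel_left]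
      exact ⟨hz, cs.simple_weakLE_altList' hab h0⟩
    · intro e hea heb
      rw [weakLE_mul_left_iff ha] at hea
      rw [weakLE_mul_left_iff hb] at heb
      rw [weakLE_mul_left_iff hz]
      exact ⟨hea.1, (cs.weakLE_altList hab hea.2 heb.2).2⟩

/-- A finite Coxeter group has a greatest element for the weak order. -/
theorem exists_weak_greatest [Finite W] : ∃ w₀, ∀ w, cs.WeakLE w w₀ := by
  obtain ⟨w₀, hw₀⟩ := Finite.exists_max cs.length
  refine ⟨w₀, fun w => ?_⟩
  obtain ⟨ω, hω, rfl⟩ := cs.exists_isReduced w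
  induction ω using List.reverseRecOn with
  | nil => simp [WeakLE]
  | append_singleton ω i ih =>
    have hω' : cs.IsReduced ω := by simpa using hω.take ω.length
    have ih' := ih hω'
    have hx : cs.WeakLE (cs.wordProd ω) (cs.wordProd ω * cs.simple i) := by
      rw [weakLE_mul_iff, hω'.eq, length_simple]
      simpa [wordProd_append] using hω.eq.symm
    rw [wordProd_append, wordProd_singleton, weakLE_mul_left_iff hx]
    refine ⟨ih', ?_⟩
    rw [weakLE_simple_iff, ← isLeftInversion_simple_iff_isLeftDescent]
    set x := cs.wordProd ω
    have ht : cs.IsReflection (x * cs.simple i * x⁻¹) := ⟨x, i, rfl⟩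
    have hinv : cs.IsLeftInversion (x * (x⁻¹ * w₀)) (x * cs.simple i * x⁻¹) := by
      rw [mul_inv_cancel_left]
      exact ⟨ht, lt_of_le_of_ne (hw₀ _) (ht.length_mul_right_ne w₀)⟩
    obtain h | h := hinv.of_mul
    · have := h.2
      rw [inv_mul_cancel_right] at this
      exact absurd hx.length_le this.not_ge
    · simpa [mul_assoc] using h

/-- In a finite Coxeter group, `w` has a greatest prefix `v` such that `u * v` is reduced. -/
theorem exists_greatest_reduced_prefix [Finite W] (u w : W) :
    ∃ v, cs.WeakLE v w ∧ cs.WeakLE u (u * v) ∧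
      ∀ v', cs.WeakLE v' w → cs.WeakLE u (u * v') → cs.WeakLE v' v := by
  obtain ⟨w₀, hw₀⟩ := cs.exists_weak_greatest
  have hiff : ∀ v, cs.WeakLE u (u * v) ↔ cs.WeakLE v (u⁻¹ * w₀) := by
    intro v
    constructor
    · intro h
      exact ((weakLE_mul_left_iff h).1 (hw₀ _)).2
    · intro h
      rw [weakLE_mul_iff]
      have h1 := hw₀ u
      rw [WeakLE] at h h1
      have h2 := cs.length_mul_le (u * v) (v⁻¹ * (u⁻¹ * w₀))
      have h3 := cs.length_mul_le u v
      simp only [mul_assoc, mul_inv_cancel_left] at h2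
      omega
  simp_rw [hiff]
  obtain ⟨⟨v, hv, hv'⟩, hmax⟩ := @Finite.exists_max
    {v : W // cs.WeakLE v w ∧ cs.WeakLE v (u⁻¹ * w₀)} _ _ ⟨⟨1, by simp [WeakLE]⟩⟩ _
    (fun v => cs.length v.1)
  refine ⟨v, hv, hv', fun v' h h' => ?_⟩
  obtain ⟨j, hj, hj', hjmin⟩ := cs.exists_weak_join hv h
  have := hmax ⟨j, hjmin _ hv h, hjmin _ hv' h'⟩
  rw [hj.eq_of_length_le this]
  exact hj'

/-- The greatest prefix `v` of `w` such that `u * v` is reduced. -/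
noncomputable def reducedPrefix [Finite W] (u w : W) : W :=
  (cs.exists_greatest_reduced_prefix u w).choose

section reducedPrefix

variable [Finite W] {cs} {u u' v w : W}

lemma reducedPrefix_weakLE : cs.WeakLE (cs.reducedPrefix u w) w :=
  (cs.exists_greatest_reduced_prefix u w).choose_spec.1

lemma weakLE_mul_reducedPrefix : cs.WeakLE u (u * cs.reducedPrefix u w) :=
  (cs.exists_greatest_reduced_prefix u w).choose_spec.2.1

lemma weakLE_reducedPrefix (h : cs.WeakLE v w) (h' : cs.WeakLE u (u * v)) :
    cs.WeakLE v (cs.reducedPrefix u w) :=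
  (cs.exists_greatest_reduced_prefix u w).choose_spec.2.2 v h h'

lemma reducedPrefix_one : cs.reducedPrefix 1 w = w :=
  reducedPrefix_weakLE.antisymm (weakLE_reducedPrefix (.refl w) (by simp [WeakLE]))

lemma mul_reducedPrefix_mul (h : cs.WeakLE u (u * u')) :
    u' * cs.reducedPrefix (u * u') w = cs.reducedPrefix u (u' * cs.reducedPrefix u' w) := by
  set v := cs.reducedPrefix u' w with hv
  have hv₁ : cs.WeakLE u' (u' * v) := weakLE_mul_reducedPrefix
  have assoc : ∀ x, cs.WeakLE u' (u' * x) →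
      (cs.WeakLE u (u * (u' * x)) ↔ cs.WeakLE (u * u') (u * u' * x)) := by
    intro x hx
    rw [mul_assoc]
    rw [weakLE_mul_iff] at h hx ⊢
    rw [← mul_assoc, weakLE_mul_iff, mul_assoc]
    constructor <;> intro <;> omega
  apply WeakLE.antisymm
  · have h1 := weakLE_mul_reducedPrefix (cs := cs) (u := u * u') (w := w)
    have h2 := h1.of_mul h
    apply weakLE_reducedPrefix
    · rw [weakLE_mul_left_iff h2, inv_mul_cancel_left]
      exact ⟨hv₁, weakLE_reducedPrefix reducedPrefix_weakLE h2⟩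
    · rwa [assoc _ h2]
  · set q := cs.reducedPrefix u (u' * v)
    have hq : cs.WeakLE u' q := weakLE_reducedPrefix hv₁ h
    obtain ⟨x, hx⟩ : ∃ x, q = u' * x := ⟨u'⁻¹ * q, by simp⟩
    have hqv : cs.WeakLE q (u' * v) := reducedPrefix_weakLE
    have hqu : cs.WeakLE u (u * q) := weakLE_mul_reducedPrefix
    rw [hx] at hq hqv hqu ⊢
    rw [assoc x hq] at hqu
    rw [weakLE_mul_left_iff hq, inv_mul_cancel_left] at hqv ⊢
    exact ⟨weakLE_mul_reducedPrefix.of_mul h,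
      weakLE_reducedPrefix (hqv.2.trans reducedPrefix_weakLE) hqu⟩

end reducedPrefix

end CoxeterSystem

namespace ArtinTitsMonoid

open CoxeterSystem hiding lift

variable {B : Type*} {M : CoxeterMatrix B}

variable (M) in
/-- The generators of the Artin–Tits monoid. -/
def gen (i : B) : ArtinTitsMonoid M := PresentedMonoid.of (artinTitsRels M) i

variable (M) in
/-- The element of the Artin–Tits monoid represented by a word. -/
def ofWord (ω : List B) : ArtinTitsMonoid M := (ω.map (gen M)).prod

@[simp]
lemma ofWord_nil : ofWord M [] = 1 := rfl

lemma ofWord_cons (i : B) (ω : List B) : ofWord M (i :: ω) = gen M i * ofWord M ω := by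
  simp [ofWord]

lemma ofWord_append (ω ω' : List B) : ofWord M (ω ++ ω') = ofWord M ω * ofWord M ω' := by
  simp [ofWord]

lemma ofWord_eq_mk (ω : List B) :
    ofWord M ω = PresentedMonoid.mk (artinTitsRels M) (FreeMonoid.ofList ω) := by
  induction ω with
  | nil => exact (map_one (PresentedMonoid.mk (artinTitsRels M))).symm
  | cons i ω ih =>
    rw [ofWord_cons, ih, FreeMonoid.ofList_cons, map_mul]
    rfl

lemma ofWord_altList {a b : B} (hab : a ≠ b) (h0 : M a b ≠ 0) :
    ofWord M (altList a b (M a b)) = ofWord M (altList b a (M a b)) := by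
  have h : ofWord M (CoxeterSystem.alternatingWord a b (M a b)) =
      ofWord M (CoxeterSystem.alternatingWord b a (M a b)) := by
    rw [ofWord_eq_mk, ofWord_eq_mk]
    exact PresentedMonoid.mk_eq_mk_of_rel ⟨a, b, hab, h0, rfl, rfl⟩
  rw [alternatingWord_eq_altList, alternatingWord_eq_altList] at h
  split_ifs at h
  · exact h
  · exact h.symm

@[elab_as_elim]
lemma gen_mul_induction {p : ArtinTitsMonoid M → Prop} (one : p 1)
    (gen_mul : ∀ i x, p x → p (gen M i * x)) (x : ArtinTitsMonoid M) : p x := by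
  obtain ⟨ω, rfl⟩ := PresentedMonoid.surjective_mk x
  have h : ∀ ω : List B, p (ofWord M ω) := by
    intro ω
    induction ω with
    | nil => exact one
    | cons i ω ih =>
      rw [ofWord_cons]
      exact gen_mul i _ ih
  have h' := h (FreeMonoid.toList ω)
  rwa [ofWord_eq_mk] at h'

section lift

variable {N : Type*} [Monoid N] (f : B → N)
  (h : ∀ a b, a ≠ b → M a b ≠ 0 →
    ((altList a b (M a b)).map f).prod = ((altList b a (M a b)).map f).prod)

/-- The universal property of the Artin–Tits monoid. -/
def lift : ArtinTitsMonoid M →* N :=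
  PresentedMonoid.lift (rels := artinTitsRels M) f <| by
    rintro _ _ ⟨a, b, hab, h0, rfl, rfl⟩
    rw [FreeMonoid.lift_apply, FreeMonoid.lift_apply, FreeMonoid.toList_ofList,
      FreeMonoid.toList_ofList, alternatingWord_eq_altList, alternatingWord_eq_altList]
    split_ifs
    · exact h a b hab h0
    · exact (h a b hab h0).symm

@[simp]
lemma lift_gen (i : B) : lift f h (gen M i) = f i :=
  PresentedMonoid.lift_of (rels := artinTitsRels M) f _

end lift

variable (M) in
/-- The word length, as a monoid homomorphism. -/
def lengthHom : ArtinTitsMonoid M →* Multiplicative ℕ :=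
  lift (fun _ => Multiplicative.ofAdd 1) (by simp [length_altList])

/-- The word length of an element of the Artin–Tits monoid. -/
def length (x : ArtinTitsMonoid M) : ℕ := (lengthHom M x).toAdd

lemma length_mul (x y : ArtinTitsMonoid M) : length (x * y) = length x + length y := by
  simp [length]

lemma length_gen (i : B) : length (gen M i) = 1 := by
  simp [length, lengthHom]

section LeftDvd

variable {N : Type*} [Monoid N]

lemma leftDvd_refl (x : N) : LeftDvd x x := ⟨1, by simp⟩

lemma leftDvd_mul_right (x y : N) : LeftDvd x (x * y) := ⟨y, rfl⟩

lemma leftDvd_trans {x y z : N} (h : LeftDvd x y) (h' : LeftDvd y z) : LeftDvd x z := by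
  obtain ⟨u, rfl⟩ := h
  obtain ⟨v, rfl⟩ := h'
  exact ⟨u * v, mul_assoc _ _ _⟩

lemma leftDvd_mul_left {x y : N} (z : N) (h : LeftDvd x y) : LeftDvd (z * x) (z * y) := by
  obtain ⟨u, rfl⟩ := h
  exact ⟨u, (mul_assoc _ _ _).symm⟩

end LeftDvd

section canonicalLift

variable {W : Type*} [Group W] (cs : CoxeterSystem M W)

/-- Matsumoto's theorem: reduced words of the same element of the Coxeter group represent the same
element of the Artin–Tits monoid. -/
theorem ofWord_eq_of_isReduced {ω ω' : List B} (hω : cs.IsReduced ω) (hω' : cs.IsReduced ω')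
    (h : cs.wordProd ω = cs.wordProd ω') : ofWord M ω = ofWord M ω' := by
  induction hn : ω.length generalizing ω ω' with
  | zero =>
    have hl : ω'.length = 0 := by rw [← hω'.eq, ← h, hω.eq, hn]
    rw [List.length_eq_zero_iff] at hn hl
    rw [hn, hl]
  | succ n ih =>
    have hl : ω'.length = n + 1 := by rw [← hω'.eq, ← h, hω.eq, hn]
    obtain ⟨a, t, rfl⟩ := List.exists_cons_of_length_eq_add_one hn
    obtain ⟨b, t', rfl⟩ := List.exists_cons_of_length_eq_add_one hl
    have ht : cs.IsReduced t := hω.drop 1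
    have ht' : cs.IsReduced t' := hω'.drop 1
    simp only [List.length_cons, add_left_inj] at hn hl
    by_cases hab : a = b
    · subst hab
      rw [wordProd_cons, wordProd_cons, mul_right_inj] at h
      rw [ofWord_cons, ofWord_cons, ih ht ht' h hn]
    have ha : cs.IsLeftDescent (cs.wordProd (a :: t)) a := by
      rw [isLeftDescent_iff, hω.eq, wordProd_cons, simple_mul_simple_cancel_left, ht.eq,
        List.length_cons]
    have hb : cs.IsLeftDescent (cs.wordProd (a :: t)) b := by
      rw [isLeftDescent_iff, h, hω'.eq, wordProd_cons, simple_mul_simple_cancel_left, ht'.eq,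
        List.length_cons]
    obtain ⟨h0, hlen⟩ := cs.length_eq_of_isLeftDescent hab ha hb
    obtain ⟨η, hη, hy⟩ := cs.exists_isReduced ((cs.wordProd (altList a b (M a b)))⁻¹ *
      cs.wordProd (a :: t))
    obtain ⟨k, hk⟩ := Nat.exists_eq_succ_of_ne_zero h0
    rw [hy, hη.eq, hω.eq, List.length_cons, hn] at hlen
    rw [inv_mul_eq_iff_eq_mul] at hy
    have key : ∀ c d s, cs.IsReduced s → s.length = n →
        cs.wordProd (c :: s) = cs.wordProd (altList c d (M a b)) * cs.wordProd η →
        ofWord M (c :: s) = ofWord M (altList c d (M a b)) * ofWord M η := by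
      intro c d s hs hsn hcs
      rw [hk, Nat.succ_eq_add_one, altList_succ, wordProd_cons, wordProd_cons, mul_assoc,
        mul_right_inj, ← wordProd_append] at hcs
      have hlen' : (altList d c k ++ η).length = n := by
        rw [List.length_append, length_altList]
        omega
      have hred : cs.IsReduced (altList d c k ++ η) := by
        rw [CoxeterSystem.IsReduced, ← hcs, hs.eq, hsn, hlen']
      rw [ofWord_cons, ih hs hred hcs hsn, ofWord_append, hk, Nat.succ_eq_add_one, altList_succ,
        ofWord_cons, mul_assoc]
    rw [key a b t ht hn hy, key b a t' ht' hl (by rw [← h, hy, wordProd_altList_braid]),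
      ofWord_altList hab h0]

/-- The lift to the Artin–Tits monoid of an element of the Coxeter group, through a reduced
word. -/
noncomputable def canonicalLift (w : W) : ArtinTitsMonoid M :=
  ofWord M (cs.exists_isReduced w).choose

lemma canonicalLift_wordProd {ω : List B} (hω : cs.IsReduced ω) :
    canonicalLift cs (cs.wordProd ω) = ofWord M ω :=
  ofWord_eq_of_isReduced cs (cs.exists_isReduced _).choose_spec.1 hω
    (cs.exists_isReduced _).choose_spec.2.symm

variable {cs}

lemma canonicalLift_mul {x y : W} (h : cs.WeakLE x (x * y)) :
    canonicalLift cs (x * y) = canonicalLift cs x * canonicalLift cs y := by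
  obtain ⟨ω, hω, rfl⟩ := cs.exists_isReduced x
  obtain ⟨η, hη, rfl⟩ := cs.exists_isReduced y
  have hr : cs.IsReduced (ω ++ η) := by
    rw [weakLE_mul_iff, hω.eq, hη.eq] at h
    rw [CoxeterSystem.IsReduced, wordProd_append, ← h, List.length_append]
  rw [← wordProd_append, canonicalLift_wordProd cs hr, canonicalLift_wordProd cs hω,
    canonicalLift_wordProd cs hη, ofWord_append]

lemma canonicalLift_mul_inv_mul {x y : W} (h : cs.WeakLE x y) :
    canonicalLift cs x * canonicalLift cs (x⁻¹ * y) = canonicalLift cs y := by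
  rw [← canonicalLift_mul (by rwa [mul_inv_cancel_left]), mul_inv_cancel_left]

lemma leftDvd_canonicalLift {u w : W} (h : cs.WeakLE u w) :
    LeftDvd (canonicalLift cs u) (canonicalLift cs w) :=
  ⟨_, (canonicalLift_mul_inv_mul h).symm⟩

variable (cs)

@[simp]
lemma canonicalLift_one : canonicalLift cs 1 = 1 := by
  have h : cs.IsReduced [] := by simp [CoxeterSystem.IsReduced]
  simpa using canonicalLift_wordProd cs h

@[simp]
lemma canonicalLift_simple (i : B) : canonicalLift cs (cs.simple i) = gen M i := by
  have h : cs.IsReduced [i] := by simp [CoxeterSystem.IsReduced]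
  simpa [ofWord] using canonicalLift_wordProd cs h

lemma canonicalLift_altList {a b : B} (hab : a ≠ b) :
    canonicalLift cs (cs.wordProd (altList a b (M a b))) = ofWord M (altList a b (M a b)) :=
  canonicalLift_wordProd cs <| by
    rw [CoxeterSystem.IsReduced, cs.length_wordProd_altList hab (.inr le_rfl), length_altList]

end canonicalLift

section action

variable {W : Type*} [Group W] [Finite W] (cs : CoxeterSystem M W)

/-- The operation on pairs `(w, c)`, thought of as products in the Artin–Tits monoid whose greatest
simple prefix is being computed, which multiplies on the left by `u`. -/
noncomputable def headMul (u : W) : Function.End (W × ArtinTitsMonoid M) := fun p =>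
  (u * cs.reducedPrefix u p.1, canonicalLift cs ((cs.reducedPrefix u p.1)⁻¹ * p.1) * p.2)

lemma headMul_one : headMul cs 1 = 1 := by
  funext p
  simp [headMul, reducedPrefix_one, Function.End.one_def]

variable {cs} in
lemma headMul_headMul {u u' : W} (h : cs.WeakLE u (u * u')) (p : W × ArtinTitsMonoid M) :
    headMul cs u (headMul cs u' p) = headMul cs (u * u') p := by
  obtain ⟨w, c⟩ := p
  simp only [headMul, ← mul_reducedPrefix_mul h]
  have h1 : cs.WeakLE u' (u' * cs.reducedPrefix (u * u') w) := weakLE_mul_reducedPrefix.of_mul h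
  have h2 : cs.WeakLE (cs.reducedPrefix (u * u') w) (cs.reducedPrefix u' w) :=
    weakLE_reducedPrefix reducedPrefix_weakLE h1
  have h3 : cs.WeakLE (cs.reducedPrefix u' w) w := reducedPrefix_weakLE
  rw [mul_assoc, ← mul_assoc _ _ c, ← canonicalLift_mul]
  · congr 2
    group
  · have h4 := h2.trans h3
    rw [WeakLE] at *
    simp only [mul_inv_rev, inv_inv, mul_assoc, mul_inv_cancel_left, inv_mul_cancel_left]
    omega

lemma canonicalLift_headMul (u : W) (p : W × ArtinTitsMonoid M) :
    canonicalLift cs (headMul cs u p).1 * (headMul cs u p).2 =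
      canonicalLift cs u * (canonicalLift cs p.1 * p.2) := by
  rw [headMul, canonicalLift_mul weakLE_mul_reducedPrefix, mul_assoc, ← mul_assoc _ _ p.2,
    canonicalLift_mul_inv_mul reducedPrefix_weakLE]

lemma eq_of_headMul_eq {u : W} {p q : W × ArtinTitsMonoid M}
    (h : headMul cs u p = headMul cs u q) :
    canonicalLift cs p.1 * p.2 = canonicalLift cs q.1 * q.2 := by
  rw [headMul, headMul, Prod.mk.injEq, mul_right_inj] at h
  rw [← canonicalLift_mul_inv_mul (reducedPrefix_weakLE (cs := cs) (u := u) (w := p.1)),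
    ← canonicalLift_mul_inv_mul (reducedPrefix_weakLE (cs := cs) (u := u) (w := q.1)),
    mul_assoc, mul_assoc, h.1]
  rw [h.1] at h
  rw [h.2]

lemma prod_map_headMul {ω : List B} (hω : cs.IsReduced ω) :
    (ω.map fun i => headMul cs (cs.simple i)).prod = headMul cs (cs.wordProd ω) := by
  induction ω with
  | nil => rw [wordProd_nil, headMul_one, List.map_nil, List.prod_nil]
  | cons i ω ih =>
    have hω' : cs.IsReduced ω := hω.drop 1
    rw [List.map_cons, List.prod_cons, ih hω', wordProd_cons]
    refine funext (headMul_headMul ?_)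
    rw [weakLE_mul_iff, ← wordProd_cons, hω.eq, hω'.eq, length_simple, List.length_cons, add_comm]

/-- The action of the Artin–Tits monoid on pairs by which greatest simple prefixes are computed. -/
noncomputable def headAction : ArtinTitsMonoid M →* Function.End (W × ArtinTitsMonoid M) :=
  lift (fun i => headMul cs (cs.simple i)) <| by
    intro a b hab _
    have h1 : cs.IsReduced (altList a b (M a b)) := by
      rw [CoxeterSystem.IsReduced, cs.length_wordProd_altList hab (.inr le_rfl), length_altList]
    have h2 : cs.IsReduced (altList b a (M a b)) := by
      rw [CoxeterSystem.IsReduced, cs.length_wordProd_altList (Ne.symm hab)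
        (.inr (M.symmetric a b).le), length_altList]
    rw [prod_map_headMul cs h1, prod_map_headMul cs h2, wordProd_altList_braid]

/-- The greatest simple prefix of an element of the Artin–Tits monoid, together with the
corresponding quotient. -/
noncomputable def headPair (x : ArtinTitsMonoid M) : W × ArtinTitsMonoid M :=
  headAction cs x (1, 1)

lemma headPair_gen_mul (i : B) (x : ArtinTitsMonoid M) :
    headPair cs (gen M i * x) = headMul cs (cs.simple i) (headPair cs x) := by
  rw [headPair, map_mul, headAction, lift_gen]
  rfl

lemma canonicalLift_headPair (x : ArtinTitsMonoid M) :
    canonicalLift cs (headPair cs x).1 * (headPair cs x).2 = x := by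
  induction x using gen_mul_induction with
  | one => simp [headPair, Function.End.one_def]
  | gen_mul i x ih => rw [headPair_gen_mul, canonicalLift_headMul, ih, canonicalLift_simple]

theorem mul_left_cancel' (cs : CoxeterSystem M W) {x y z : ArtinTitsMonoid M}
    (h : x * y = x * z) : y = z := by
  induction x using gen_mul_induction with
  | one => simpa using h
  | gen_mul i x ih =>
    apply ih
    rw [mul_assoc, mul_assoc] at h
    have h' := congrArg (headPair cs) h
    rw [headPair_gen_mul, headPair_gen_mul] at h'
    simpa only [canonicalLift_headPair] using eq_of_headMul_eq cs h'

lemma simple_weakLE_headPair {i : B} {x : ArtinTitsMonoid M} (h : LeftDvd (gen M i) x) :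
    cs.WeakLE (cs.simple i) (headPair cs x).1 := by
  obtain ⟨y, rfl⟩ := h
  rw [headPair_gen_mul]
  exact weakLE_mul_reducedPrefix

lemma leftDvd_altList (cs : CoxeterSystem M W) {a b : B} (hab : a ≠ b) {x : ArtinTitsMonoid M}
    (ha : LeftDvd (gen M a) x) (hb : LeftDvd (gen M b) x) :
    M a b ≠ 0 ∧ LeftDvd (ofWord M (altList a b (M a b))) x := by
  obtain ⟨h0, h⟩ := cs.weakLE_altList hab (simple_weakLE_headPair cs ha)
    (simple_weakLE_headPair cs hb)
  refine ⟨h0, ?_⟩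
  rw [← canonicalLift_altList cs hab]
  exact leftDvd_trans (leftDvd_canonicalLift h) ⟨_, (canonicalLift_headPair cs x).symm⟩

lemma leftDvd_of_mul_left (cs : CoxeterSystem M W) {x y z : ArtinTitsMonoid M}
    (h : LeftDvd (x * y) (x * z)) : LeftDvd y z := by
  obtain ⟨u, hu⟩ := h
  exact ⟨u, mul_left_cancel' cs (by rw [hu, mul_assoc])⟩

lemma gen_leftDvd_altList {a b : B} (h0 : M a b ≠ 0) :
    LeftDvd (gen M a) (ofWord M (altList a b (M a b))) := by
  obtain ⟨k, hk⟩ := Nat.exists_eq_succ_of_ne_zero h0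
  rw [hk, Nat.succ_eq_add_one, altList_succ, ofWord_cons]
  exact leftDvd_mul_right _ _

/-- Two elements of the Artin–Tits monoid with a common right-multiple have a least one. -/
theorem exists_lcm_of_leftDvd (cs : CoxeterSystem M W) {a b d : ArtinTitsMonoid M}
    (had : LeftDvd a d) (hbd : LeftDvd b d) :
    ∃ c, LeftDvd a c ∧ LeftDvd b c ∧ ∀ e, LeftDvd a e → LeftDvd b e → LeftDvd c e := by
  refine exists_least_upper_bound_of_local LeftDvd (fun z x => ∃ i, x = z * gen M i) length
    leftDvd_refl leftDvd_trans ?_ ?_ ?_ ?_ (z := 1) ⟨a, (one_mul a).symm⟩ ⟨b, (one_mul b).symm⟩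
    had hbd
  · rintro x _ ⟨u, rfl⟩
    rw [length_mul]
    omega
  · rintro x _ ⟨i, rfl⟩
    rw [length_mul, length_gen]
    omega
  · rintro x _ ⟨u, rfl⟩
    induction u using gen_mul_induction with
    | one => exact .inl ⟨1, by simp⟩
    | gen_mul i u _ => exact .inr ⟨_, ⟨i, rfl⟩, u, (mul_assoc _ _ _).symm⟩
  · rintro z _ _ d ⟨i, rfl⟩ ⟨j, rfl⟩ hid hjd
    by_cases hij : i = j
    · subst hij
      exact ⟨_, leftDvd_refl _, leftDvd_refl _, fun e h _ => h⟩
    have key : ∀ e, LeftDvd (z * gen M i) e → LeftDvd (z * gen M j) e →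
        M i j ≠ 0 ∧ LeftDvd (z * ofWord M (altList i j (M i j))) e := by
      intro e hie hje
      obtain ⟨u, rfl⟩ := leftDvd_trans (leftDvd_mul_right _ _) hie
      obtain ⟨h0, h⟩ := leftDvd_altList cs hij (leftDvd_of_mul_left cs hie)
        (leftDvd_of_mul_left cs hje)
      exact ⟨h0, leftDvd_mul_left z h⟩
    have h0 := (key d hid hjd).1
    refine ⟨_, leftDvd_mul_left z (gen_leftDvd_altList h0), leftDvd_mul_left z ?_,
      fun e hie hje => (key e hie hje).2⟩
    rw [ofWord_altList hij h0, M.symmetric i j]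
    rw [M.symmetric i j] at h0
    exact gen_leftDvd_altList h0

/-- Any two elements of an Artin–Tits monoid of spherical type have a common right-multiple. -/
theorem exists_mul_eq_mul (cs : CoxeterSystem M W) (a b : ArtinTitsMonoid M) :
    ∃ x y, a * x = b * y := by
  obtain ⟨w₀, hw₀⟩ := cs.exists_weak_greatest
  have conj : ∀ i, ∃ j, gen M i * canonicalLift cs w₀ = canonicalLift cs w₀ * gen M j := by
    intro i
    have h1 := hw₀ (cs.simple i)
    have h2 := hw₀ (cs.simple i * w₀)
    have h3 : cs.length (w₀⁻¹ * cs.simple i * w₀) = 1 := by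
      rw [WeakLE, length_simple, inv_simple] at h1
      rw [WeakLE, mul_inv_rev, inv_simple] at h2
      omega
    obtain ⟨j, hj⟩ := cs.length_eq_one_iff.1 h3
    refine ⟨j, ?_⟩
    have e1 := canonicalLift_mul_inv_mul h1
    have e2 := canonicalLift_mul_inv_mul h2
    rw [inv_simple, canonicalLift_simple] at e1
    rw [mul_inv_rev, inv_simple, hj, canonicalLift_simple] at e2
    rw [← e2, ← mul_assoc, e1, e2]
  have conj' : ∀ x, ∃ y, x * canonicalLift cs w₀ = canonicalLift cs w₀ * y := by
    intro x
    induction x using gen_mul_induction with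
    | one => exact ⟨1, by simp⟩
    | gen_mul i x ih =>
      obtain ⟨y, hy⟩ := ih
      obtain ⟨j, hj⟩ := conj i
      exact ⟨gen M j * y, by rw [mul_assoc, hy, ← mul_assoc, hj, mul_assoc]⟩
  induction a using gen_mul_induction generalizing b with
  | one => exact ⟨b, 1, by simp⟩
  | gen_mul i a ih =>
    obtain ⟨y, hy⟩ := conj' b
    have h1 := canonicalLift_mul_inv_mul (hw₀ (cs.simple i))
    rw [canonicalLift_simple] at h1
    obtain ⟨x, z, hxz⟩ := ih (canonicalLift cs ((cs.simple i)⁻¹ * w₀) * y)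
    exact ⟨x, canonicalLift cs w₀ * z, by
      rw [mul_assoc, hxz, mul_assoc, ← mul_assoc (gen M i), h1, ← mul_assoc b, hy, mul_assoc]⟩

end action

end ArtinTitsMonoid

/-- For a Coxeter matrix `M` on a finite index set whose Coxeter group is finite
(spherical type), any two elements of the Artin–Tits monoid `A⁺(M)` admit a least common
right-multiple. -/
theorem artinTitsMonoid_exists_lcm {B : Type*} [Finite B] (M : CoxeterMatrix B)
    (hW : Finite M.Group) (a b : ArtinTitsMonoid M) :
    ∃ c : ArtinTitsMonoid M, LeftDvd a c ∧ LeftDvd b c ∧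
      ∀ d : ArtinTitsMonoid M, LeftDvd a d → LeftDvd b d → LeftDvd c d := by
  obtain ⟨x, y, h⟩ := ArtinTitsMonoid.exists_mul_eq_mul M.toCoxeterSystem a b
  exact ArtinTitsMonoid.exists_lcm_of_leftDvd M.toCoxeterSystem ⟨x, rfl⟩ ⟨y, h⟩
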